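/- arXiv:2003.04945 — 8 statements merged into one kernel-verified Lean document; each statement's English description precedes it below -/
import Mathlib

section
/- Let p be a prime and let G be a group that is residually a finite p-group. If G has a solvable subgroup of finite index, then G is solvable. -/
/-- If `G` is residually a finite `p`-group (every nontrivial element is excluded by some
finite-index normal subgroup with finite `p`-group quotient) and `G` has a solvable
subgroup of finite index, then `G` is solvable. -/
theorem residually_finite_p_virtually_solvable_is_solvable
    {p : ℕ} (hp : p.Prime) {G : Type*} [Group G]
    (hres : ∀ g : G, g ≠ 1 → ∃ N : Subgroup G, ∃ _ : N.Normal,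
      N.FiniteIndex ∧ g ∉ N ∧ IsPGroup p (G ⧸ N))
    (H : Subgroup G) (hHfi : H.FiniteIndex) (hHsolv : IsSolvable H) :
    IsSolvable G := by
  haveI : Fact p.Prime := ⟨hp⟩
  have hHs2 : Group.IsSolvable H := hHsolv
  obtain ⟨K, hKn, hKf, hKs⟩ : ∃ K : Subgroup G, K.Normal ∧ K.FiniteIndex ∧ IsSolvable K :=
    ⟨H.normalCore, inferInstance, inferInstance,
      Group.isSolvable_of_isSolvable_injective (Subgroup.inclusion_injective H.normalCore_le)⟩
  obtain ⟨d, hd⟩ := (isSolvable_def K).1 hKs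
  obtain ⟨n, hn⟩ : ∃ n, ∀ k, n ≤ k →
      derivedSeries (G ⧸ K) n = derivedSeries (G ⧸ K) k := by
    have := WellFoundedGT.monotone_chain_condition
      (⟨fun i => OrderDual.toDual (derivedSeries (G ⧸ K) i),
        fun a b h => derivedSeries_antitone (G ⧸ K) h⟩ : ℕ →o (Subgroup (G ⧸ K))ᵒᵈ)
    exact this
  refine (isSolvable_def G).2 ⟨n + d, ?_⟩
  rw [eq_bot_iff]
  intro g hg
  by_contra hg1
  obtain ⟨N, hN, hNf, hgN, hP⟩ := hres g hg1
  haveI := hP.isNilpotent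
  obtain ⟨k, hk⟩ := (isSolvable_def (G ⧸ N)).1 inferInstance
  have hDk : derivedSeries G k ≤ N := by
    have h := map_derivedSeries_le_derivedSeries (QuotientGroup.mk' N) k
    rw [hk, le_bot_iff, Subgroup.map_eq_bot_iff, QuotientGroup.ker_mk'] at h
    exact h
  have hDn : derivedSeries G n ≤ N ⊔ K := by
    have h1 : (derivedSeries G n).map (QuotientGroup.mk' K) ≤
        (derivedSeries G k).map (QuotientGroup.mk' K) := by
      rw [map_derivedSeries_eq (QuotientGroup.mk'_surjective K),
        map_derivedSeries_eq (QuotientGroup.mk'_surjective K)]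
      rcases le_total n k with h | h
      · exact (hn k h).le
      · exact derivedSeries_antitone _ h
    rw [Subgroup.map_le_map_iff, QuotientGroup.ker_mk'] at h1
    exact h1.trans (sup_le_sup_right hDk K)
  have key : ∀ j, (derivedSeries G (n + j)).map (QuotientGroup.mk' N) ≤
      ((derivedSeries K j).map K.subtype).map (QuotientGroup.mk' N) := by
    intro j
    induction j with
    | zero =>
      rw [Subgroup.map_le_map_iff, QuotientGroup.ker_mk', derivedSeries_zero,
        ← MonoidHom.range_eq_map, Subgroup.range_subtype, sup_comm]
      exact hDn
    | succ j ih =>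
      rw [← add_assoc, derivedSeries_succ, derivedSeries_succ, Subgroup.map_commutator,
        Subgroup.map_commutator, Subgroup.map_commutator]
      exact Subgroup.commutator_mono ih ih
  have h := key d
  rw [hd, Subgroup.map_bot, Subgroup.map_bot, le_bot_iff, Subgroup.map_eq_bot_iff,
    QuotientGroup.ker_mk'] at h
  exact hgN (h hg)
end

section
/- Let G be a group with unique roots, i.e. for all x, y ∈ G and every nonzero integer n, x^n = y^n implies x = y. If G has an abelian subgroup of finite index, then G is abelian. -/
/-- If `G` is a group with unique roots (for all `x y : G` and nonzero integers `n`,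
`x ^ n = y ^ n` implies `x = y`) and `G` has an abelian subgroup of finite index,
then `G` is abelian. -/
theorem unique_roots_virtually_abelian_is_abelian
    {G : Type*} [Group G]
    (hroots : ∀ (x y : G) (n : ℤ), n ≠ 0 → x ^ n = y ^ n → x = y)
    (H : Subgroup G) (hHfi : H.FiniteIndex) (hHab : ∀ a b : H, a * b = b * a) :
    ∀ a b : G, a * b = b * a := by
  have key : ∀ (x y : G) (m : ℕ), 0 < m → Commute x (y ^ m) → Commute x y := by
    intro x y m hm h
    have h1 : x * y * x⁻¹ = y := by
      apply hroots _ _ (m : ℤ) (by exact_mod_cast hm.ne')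
      rw [zpow_natCast, zpow_natCast, conj_pow, h.eq, mul_inv_cancel_right]
    exact mul_inv_eq_iff_eq_mul.mp h1
  intro a b
  obtain ⟨n, hn, -, ha⟩ := Subgroup.exists_pow_mem_of_index_ne_zero hHfi.index_ne_zero a
  obtain ⟨m, hm, -, hb⟩ := Subgroup.exists_pow_mem_of_index_ne_zero hHfi.index_ne_zero b
  have h : Commute (a ^ n) (b ^ m) := congrArg Subtype.val (hHab ⟨_, ha⟩ ⟨_, hb⟩)
  exact (key b a n hn (key (a ^ n) b m hm h).symm).symm.eq
end

section
/- For every n ≥ 0, the subgroup A_n of G_n generated by x_1^2, …, x_n^2 is free abelian with basis {x_1^2, …, x_n^2}; that is, the elements x_i^2 pairwise commute, and whenever (x_1^2)^{m_1} (x_2^2)^{m_2} ⋯ (x_n^2)^{m_n} = 1 for integers m_1, …, m_n, all m_i are zero. -/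
/-- Relators of the combinatorial generalized Hantzsche-Wendt group:
`x_i⁻¹ x_j² x_i x_j²` for all `i ≠ j`. -/
def HWrels (n : ℕ) : Set (FreeGroup (Fin n)) :=
  {r | ∃ i j : Fin n, i ≠ j ∧
    r = (FreeGroup.of i)⁻¹ * (FreeGroup.of j) ^ 2 * FreeGroup.of i * (FreeGroup.of j) ^ 2}

/-- The combinatorial generalized Hantzsche-Wendt group `G_n`. -/
abbrev GHW (n : ℕ) : Type := PresentedGroup (HWrels n)

/-- The generator `x_i` of `G_n`. -/
def ghw {n : ℕ} (i : Fin n) : GHW n := PresentedGroup.of i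

open Classical in
/-- Images of the generators in the infinite dihedral group. -/
noncomputable def ghwImg {n : ℕ} (k i : Fin n) : DihedralGroup 0 :=
  if i = k then DihedralGroup.r 1 else DihedralGroup.sr 0

theorem ghwImg_sq_ne {n : ℕ} {k i : Fin n} (h : i ≠ k) : ghwImg k i ^ 2 = 1 := by
  simp [ghwImg, h, pow_two]

theorem ghwImg_rels {n : ℕ} (k : Fin n) :
    ∀ r ∈ HWrels n, FreeGroup.lift (ghwImg k) r = 1 := by
  rintro r ⟨i, j, hij, rfl⟩
  simp only [map_mul, map_inv, map_pow, FreeGroup.lift_apply_of]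
  by_cases hj : j = k
  · subst hj
    simp only [ghwImg, hij, if_true, if_false, pow_two]
    rfl
  · rw [ghwImg_sq_ne hj]; simp

theorem r_zpow_zero (a m : ℤ) : (DihedralGroup.r (Int.cast a : ZMod 0) : DihedralGroup 0) ^ m
    = DihedralGroup.r (Int.cast (a * m) : ZMod 0) := by
  simp [DihedralGroup.r_zpow]

theorem prod_map_r (L : List (ZMod 0)) :
    (L.map (DihedralGroup.r : ZMod 0 → DihedralGroup 0)).prod = DihedralGroup.r L.sum := by
  induction L with
  | nil => rfl
  | cons a L ih => simp [ih]

theorem ghw_conj {n : ℕ} {i j : Fin n} (h : i ≠ j) :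
    (ghw i : GHW n)⁻¹ * ghw j ^ 2 * ghw i * ghw j ^ 2 = 1 :=
  PresentedGroup.one_of_mem (rels := HWrels n) ⟨i, j, h, rfl⟩

/-- The subgroup `A_n = ⟨x_1², …, x_n²⟩` of `G_n` is free abelian with basis
`{x_1², …, x_n²}`: the `x_i²` pairwise commute, and any relation
`(x_1²)^{m_1} ⋯ (x_n²)^{m_n} = 1` with integer exponents forces all `m_i = 0`. -/
theorem ghw_squares_free_abelian (n : ℕ) :
    (∀ i j : Fin n, (ghw i : GHW n) ^ 2 * (ghw j) ^ 2 = (ghw j) ^ 2 * (ghw i) ^ 2) ∧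
    ∀ m : Fin n → ℤ,
      (List.ofFn fun i : Fin n => ((ghw i : GHW n) ^ 2) ^ (m i)).prod = 1 →
      ∀ i, m i = 0 := by
  refine ⟨fun i j => ?_, fun m hm k => ?_⟩
  · by_cases hij : i = j
    · rw [hij]
    · have h := ghw_conj hij
      generalize (ghw i : GHW n) = x at *
      generalize (ghw j : GHW n) ^ 2 = y at *
      have h1 : x⁻¹ * y * x = y⁻¹ := eq_inv_of_mul_eq_one_left h
      have h2 : y * x = x * y⁻¹ := by rw [← h1]; group
      have h3 : y⁻¹ * x = x * y := by
        rw [inv_mul_eq_iff_eq_mul, ← mul_assoc, h2, inv_mul_cancel_right]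
      rw [pow_two, ← mul_assoc y x x, h2, mul_assoc x y⁻¹ x, h3, mul_assoc]
  · have h := congrArg (PresentedGroup.toGroup (ghwImg_rels k)) hm
    rw [map_list_prod, map_one, List.map_ofFn] at h
    have e : (PresentedGroup.toGroup (ghwImg_rels k) ∘ fun i : Fin n => ((ghw i : GHW n) ^ 2) ^ (m i))
        = DihedralGroup.r ∘ (fun i => if i = k then (Int.cast (2 * m i) : ZMod 0) else 0) := by
      funext i
      simp only [Function.comp, map_zpow, map_pow, ghw, PresentedGroup.toGroup.of]
      by_cases hi : i = k
      · subst hi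
        have : ghwImg i i ^ 2 = DihedralGroup.r (Int.cast 2 : ZMod 0) := by
          simp only [ghwImg, if_true]; rfl
        rw [this, r_zpow_zero]; simp
      · rw [ghwImg_sq_ne hi]; simp [hi]
    rw [e, ← List.map_ofFn, prod_map_r, List.sum_ofFn, Finset.sum_ite_eq' , DihedralGroup.one_def] at h
    simp only [Finset.mem_univ, if_true, DihedralGroup.r.injEq] at h
    have h' := (CharP.intCast_eq_zero_iff (ZMod 0) 0 _).1 h
    simp at h'
    exact h'
end

section
/- If 1 ≤ m ≤ n are integers, then the natural homomorphism f : G_m → G_n determined by f(x_i) = x_i for 1 ≤ i ≤ m is injective; in particular G_m embeds in G_n. -/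
theorem ghw_rel {n : ℕ} (i j : Fin n) (h : i ≠ j) :
    (ghw i)⁻¹ * (ghw j) ^ 2 * ghw i * (ghw j) ^ 2 = 1 := by
  have := PresentedGroup.one_of_mem (rels := HWrels n) ⟨i, j, h, rfl⟩
  simpa [ghw, PresentedGroup.of] using this

/-- Universal property. -/
def ghwLift {n : ℕ} {H : Type*} [Group H] (f : Fin n → H)
    (hf : ∀ i j, i ≠ j → (f i)⁻¹ * (f j) ^ 2 * f i * (f j) ^ 2 = 1) : GHW n →* H :=
  PresentedGroup.toGroup (f := f) (by
    rintro r ⟨i, j, h, rfl⟩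
    simpa using hf i j h)

theorem ghwLift_apply {n : ℕ} {H : Type*} [Group H] (f : Fin n → H)
    (hf : ∀ i j, i ≠ j → (f i)⁻¹ * (f j) ^ 2 * f i * (f j) ^ 2 = 1) (i : Fin n) :
    ghwLift f hf (ghw i) = f i := PresentedGroup.toGroup.of _

theorem ghw_ext {n : ℕ} {H : Type*} [Group H] {f g : GHW n →* H}
    (h : ∀ i, f (ghw i) = g (ghw i)) : f = g := PresentedGroup.ext h

/-- The endomorphism inverting all generators. -/
def ghwInv (n : ℕ) : GHW n →* GHW n :=
  ghwLift (fun i => (ghw i)⁻¹) (by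
    intro i j h
    have h1 := ghw_rel i j h
    have h2 : (ghw i)⁻¹ * (ghw j) ^ 2 * ghw i = ((ghw j) ^ 2)⁻¹ := eq_inv_of_mul_eq_one_left h1
    have h3 : (ghw j) ^ 2 = ghw i * ((ghw j) ^ 2)⁻¹ * (ghw i)⁻¹ := by
      rw [← h2]; group
    rw [inv_inv, inv_pow, ← h3, mul_inv_cancel])

theorem ghwInv_apply {n : ℕ} (i : Fin n) : ghwInv n (ghw i) = (ghw i)⁻¹ :=
  ghwLift_apply _ _ i

theorem ghwInv_comp (n : ℕ) : (ghwInv n).comp (ghwInv n) = MonoidHom.id _ :=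
  ghw_ext fun i => by simp [ghwInv_apply]

/-- The automorphism inverting all generators. -/
def ghwAut (n : ℕ) : MulAut (GHW n) :=
  MonoidHom.toMulEquiv (ghwInv n) (ghwInv n) (ghwInv_comp n) (ghwInv_comp n)

theorem ghwAut_apply {n : ℕ} (i : Fin n) : ghwAut n (ghw i) = (ghw i)⁻¹ := ghwInv_apply i

theorem ghwAut_sq (n : ℕ) : ghwAut n ^ 2 = 1 := by
  ext x
  rw [pow_two]
  exact DFunLike.congr_fun (ghwInv_comp n) x

theorem ghw_embeds (m n : ℕ) (hm : 1 ≤ m) (hmn : m ≤ n) :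
    ∃ f : GHW m →* GHW n,
      (∀ i : Fin m, f (ghw i) = ghw (Fin.castLE hmn i)) ∧ Function.Injective f := by
  let f : GHW m →* GHW n := ghwLift (fun i => ghw (Fin.castLE hmn i))
    (fun i j h => ghw_rel _ _ (fun e => h (Fin.castLE_injective hmn e)))
  have hf : ∀ i : Fin m, f (ghw i) = ghw (Fin.castLE hmn i) := fun i => ghwLift_apply _ _ i
  let H := GHW m ⋊[MonoidHom.id (MulAut (GHW m))] MulAut (GHW m)
  let y : H := SemidirectProduct.inr (ghwAut m)
  have hy : y ^ 2 = 1 := by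
    change (SemidirectProduct.inr (ghwAut m) : H) ^ 2 = 1
    rw [← map_pow, ghwAut_sq, map_one]
  have hyi : y⁻¹ = y := by
    rw [inv_eq_iff_mul_eq_one, ← pow_two, hy]
  have hyx : ∀ i : Fin m, y * (SemidirectProduct.inl (ghw i) : H) * y⁻¹
      = (SemidirectProduct.inl (ghw i))⁻¹ := by
    intro i
    have := SemidirectProduct.inl_aut (φ := MonoidHom.id (MulAut (GHW m))) (ghwAut m) (ghw i)
    rw [MonoidHom.id_apply, ghwAut_apply, map_inv, map_inv] at this
    exact this.symm
  let g : GHW n →* H := ghwLift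
    (fun k => if h : k.1 < m then SemidirectProduct.inl (ghw ⟨k.1, h⟩) else y) (by
      intro i j hij
      by_cases hj : j.1 < m
      · by_cases hi : i.1 < m
        · simp only [hi, hj, dif_pos]
          rw [← map_inv, ← map_pow, ← map_mul, ← map_mul, ← map_mul, ghw_rel, map_one]
          intro e
          exact hij (Fin.ext (by simpa using e))
        · simp only [hi, hj, dif_pos, dif_neg, not_false_eq_true]
          have h1 := hyx ⟨j.1, hj⟩
          have h2 := congrArg (· ^ 2) h1
          simp only [conj_pow, inv_pow] at h2
          rw [hyi] at h2 ⊢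
          rw [h2, inv_mul_cancel]
      · simp only [hj, dif_neg, not_false_eq_true, hy]
        rw [mul_one, mul_one, inv_mul_cancel])
  refine ⟨f, hf, ?_⟩
  have hc : g.comp f = SemidirectProduct.inl := by
    apply ghw_ext
    intro i
    rw [MonoidHom.comp_apply, hf]
    refine (ghwLift_apply _ _ _).trans ?_
    simp
  have : Function.Injective (g.comp f) := by
    rw [hc]; exact SemidirectProduct.inl_injective
  exact Function.Injective.of_comp (f := g) (by simpa using this)
end

section
/- Let n ≥ 1. For 1 ≤ i ≤ n let B_i be the n×n diagonal real matrix whose (i,i) entry is 1 and whose other diagonal entries are −1, let b_i ∈ ℝ^n be a vector whose i-th coordinate is 1/2, and let β_i be the affine transformation of ℝ^n given by v ↦ B_i v + b_i. Then for each i, β_i^2 is the translation e_i by the i-th standard basis vector ε_i, and for all i ≠ j one has β_i^{-1} β_j^2 β_i β_j^2 = 1. Consequently there is a group homomorphism Φ from G_n to the group of affine transformations of ℝ^n with Φ(x_i) = β_i for all i. -/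
/-- Let `β_i` be the affine transformation `v ↦ B_i v + b_i` of `ℝ^n`, where `B_i` is
diagonal with `(i,i)` entry `1` and other diagonal entries `-1`, and the `i`-th
coordinate of `b_i` is `1/2`.  Then `β_i²` is translation by the `i`-th standard basis
vector, the `β_i` satisfy the Hantzsche-Wendt relations `β_i⁻¹ β_j² β_i β_j² = 1` for
`i ≠ j`, and consequently there is a homomorphism `Φ : G_n → Aff(ℝ^n)` with
`Φ(x_i) = β_i`. -/
theorem hw_affine_representation (n : ℕ) (hn : 1 ≤ n)
    (b : Fin n → Fin n → ℝ) (hb : ∀ i, b i i = 1 / 2)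
    (β : Fin n → ((Fin n → ℝ) ≃ᵃ[ℝ] (Fin n → ℝ)))
    (hβ : ∀ i v j, β i v j = (if j = i then v j else -v j) + b i j) :
    (∀ i v, (β i ^ 2) v = v + fun j => if j = i then (1 : ℝ) else 0) ∧
    (∀ i j, i ≠ j → (β i)⁻¹ * β j ^ 2 * β i * β j ^ 2 = 1) ∧
    ∃ Φ : GHW n →* ((Fin n → ℝ) ≃ᵃ[ℝ] (Fin n → ℝ)), ∀ i, Φ (ghw i) = β i := by
  have h1 : ∀ i v, (β i ^ 2) v = v + fun j => if j = i then (1 : ℝ) else 0 := by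
    intro i v
    ext j
    have h : (β i ^ 2) v = β i (β i v) := by rw [pow_two]; rfl
    rw [h, hβ, hβ, Pi.add_apply]
    by_cases hj : j = i
    · subst hj
      simp only [if_true, hb]
      ring
    · simp only [if_neg hj]
      ring
  have h2 : ∀ i j, i ≠ j → (β i)⁻¹ * β j ^ 2 * β i * β j ^ 2 = 1 := by
    intro i j hij
    rw [mul_assoc, mul_assoc, inv_mul_eq_one]
    ext v k
    have h : (β j ^ 2 * (β i * β j ^ 2)) v = (β j ^ 2) (β i ((β j ^ 2) v)) := rfl
    rw [h, h1, h1, Pi.add_apply, hβ, hβ, Pi.add_apply]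
    by_cases hk : k = i
    · subst hk
      simp [hij]
    · simp only [if_neg hk]
      ring
  refine ⟨h1, h2, ?_⟩
  have h3 : ∀ r ∈ HWrels n, FreeGroup.lift β r = 1 := by
    rintro r ⟨i, j, hij, rfl⟩
    simpa using h2 i j hij
  exact ⟨PresentedGroup.toGroup h3, fun i => PresentedGroup.toGroup.of h3⟩
end

section
/- Let n = 2k + 1 with k ≥ 1. For 1 ≤ i ≤ n let B_i be the n×n diagonal real matrix whose (i,i) entry is 1 and whose other diagonal entries are −1, let b_i ∈ ℝ^n have all coordinates in {0, 1/2}, and let β_i be the affine transformation v ↦ B_i v + b_i of ℝ^n. If the number of indices i ∈ {1, …, 2k} with i-th vector b_i having n-th coordinate equal to 1/2 is odd, then there exists a permutation π of {1, …, 2k} such that the square of the product P = β_{π(1)} β_{π(2)} ⋯ β_{π(2k)} is the translation by ε_n or the translation by −ε_n. -/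
def hwAlt : List ℝ → ℝ
  | [] => 0
  | a :: l => a - hwAlt l

theorem hwAlt_const (p : ℝ → Bool) (hp : p (1/2) = true) (l : List ℝ) (h : ∀ x ∈ l, x = 1 / 2) :
    (Even (l.countP p) ∧ hwAlt l = 0) ∨ (Odd (l.countP p) ∧ hwAlt l = 1 / 2) := by
  induction l with
  | nil => left; simp [hwAlt]
  | cons a l ih =>
    have ha : a = 1 / 2 := h a (by simp)
    subst ha
    rw [List.countP_cons_of_pos hp]
    rcases ih (fun x hx => h x (by simp [hx])) with ⟨h1, h2⟩ | ⟨h1, h2⟩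
    · right; exact ⟨h1.add_one, by simp [hwAlt, h2]⟩
    · left; exact ⟨h1.add_one, by simp [hwAlt, h2]⟩

theorem hwAlt_sorted (p : ℝ → Bool) (hp : p (1/2) = true) (hp0 : p 0 = false)
    (l : List ℝ) (h : ∀ x ∈ l, x = 0 ∨ x = 1 / 2) (hs : l.Pairwise (· ≤ ·)) :
    (Even (l.countP p) ∧ hwAlt l = 0) ∨
      (Odd (l.countP p) ∧ (hwAlt l = 1 / 2 ∨ hwAlt l = - (1 / 2))) := by
  induction l with
  | nil => left; simp [hwAlt]
  | cons a l ih =>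
    rcases h a (by simp) with ha | ha
    · subst ha
      rw [List.countP_cons_of_neg (by simp [hp0])]
      rcases ih (fun x hx => h x (by simp [hx])) (List.pairwise_cons.1 hs).2 with
        ⟨h1, h2⟩ | ⟨h1, h2 | h2⟩
      · left; exact ⟨h1, by simp [hwAlt, h2]⟩
      · right; exact ⟨h1, by simp [hwAlt, h2]⟩
      · right; exact ⟨h1, by simp [hwAlt, h2]⟩
    · have hall : ∀ x ∈ a :: l, x = 1 / 2 := by
        intro x hx
        rcases List.mem_cons.1 hx with rfl | hx'
        · exact ha
        · have h1 := (List.pairwise_cons.1 hs).1 x hx'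
          rcases h x hx with h2 | h2
          · rw [ha, h2] at h1; norm_num at h1
          · exact h2
      rcases hwAlt_const p hp _ hall with h1 | ⟨h1, h2⟩
      · exact Or.inl h1
      · exact Or.inr ⟨h1, Or.inl h2⟩

theorem hw_prod_coord {n : ℕ} (b : Fin n → Fin n → ℝ)
    (β : Fin n → ((Fin n → ℝ) ≃ᵃ[ℝ] (Fin n → ℝ)))
    (hβ : ∀ i v j, β i v j = (if j = i then v j else -v j) + b i j) (j : Fin n)
    (L : List (Fin n)) :
    ∃ c, ∀ v, (L.map β).prod v j = (L.map fun i => if j = i then (1:ℝ) else -1).prod * v j + c := by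
  induction L with
  | nil => exact ⟨0, fun v => by simp⟩
  | cons a L ih =>
    obtain ⟨c, hc⟩ := ih
    refine ⟨(if j = a then (1:ℝ) else -1) * c + b a j, fun v => ?_⟩
    simp only [List.map_cons, List.prod_cons, AffineEquiv.mul_def, AffineEquiv.trans_apply, hβ, hc]
    split_ifs <;> ring

theorem hw_prod_last {n : ℕ} (b : Fin n → Fin n → ℝ)
    (β : Fin n → ((Fin n → ℝ) ≃ᵃ[ℝ] (Fin n → ℝ)))
    (hβ : ∀ i v j, β i v j = (if j = i then v j else -v j) + b i j) (j : Fin n)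
    (L : List (Fin n)) (hL : j ∉ L) (v) :
    (L.map β).prod v j = (-1) ^ L.length * v j + hwAlt (L.map fun i => b i j) := by
  induction L with
  | nil => simp [hwAlt]
  | cons a L ih =>
    simp only [List.mem_cons, not_or] at hL
    simp only [List.map_cons, List.prod_cons, AffineEquiv.mul_def, AffineEquiv.trans_apply, hβ,
      ih hL.2, hL.1, if_false, hwAlt, List.length_cons]
    ring

/-- Let `n = 2k + 1` with `k ≥ 1`, and for each `i` let `β_i : v ↦ B_i v + b_i` be the
affine transformation of `ℝ^n` where `B_i` is diagonal with `(i,i)` entry `1` and other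
diagonal entries `-1`, and all coordinates of `b_i` lie in `{0, 1/2}`.  If the number of
indices `i ∈ {1, …, 2k}` with `n`-th coordinate of `b_i` equal to `1/2` is odd, then for
some permutation `π` of `{1, …, 2k}`, the square of `P = β_{π(1)} ⋯ β_{π(2k)}` is the
translation by `ε_n` or by `-ε_n`. -/
theorem hw_affine_product_square_translation (k : ℕ) (hk : 1 ≤ k)
    (b : Fin (2 * k + 1) → Fin (2 * k + 1) → ℝ)
    (hb : ∀ i j, b i j = 0 ∨ b i j = 1 / 2)
    (β : Fin (2 * k + 1) → ((Fin (2 * k + 1) → ℝ) ≃ᵃ[ℝ] (Fin (2 * k + 1) → ℝ)))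
    (hβ : ∀ i v j, β i v j = (if j = i then v j else -v j) + b i j)
    (hodd : Odd (Finset.univ.filter
      (fun i : Fin (2 * k) => b i.castSucc (Fin.last (2 * k)) = 1 / 2)).card) :
    ∃ π : Equiv.Perm (Fin (2 * k)),
      (∀ v, (((List.ofFn fun i : Fin (2 * k) => β (π i).castSucc).prod ^ 2) v =
        v + fun j => if j = Fin.last (2 * k) then (1 : ℝ) else 0)) ∨
      (∀ v, (((List.ofFn fun i : Fin (2 * k) => β (π i).castSucc).prod ^ 2) v =
        v - fun j => if j = Fin.last (2 * k) then (1 : ℝ) else 0)) := by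
  classical
  set f : Fin (2 * k) → ℝ := fun i => b i.castSucc (Fin.last (2 * k)) with hf
  set π := Tuple.sort f with hπ
  have hmono : Monotone (f ∘ π) := Tuple.monotone_sort f
  set L : List (Fin (2 * k + 1)) := List.ofFn fun i : Fin (2 * k) => (π i).castSucc with hLdef
  have hP : (List.ofFn fun i : Fin (2 * k) => β (π i).castSucc) = L.map β := by
    rw [hLdef, List.map_ofFn]; rfl
  have hlast : Fin.last (2 * k) ∉ L := by
    simp only [hLdef, List.mem_ofFn]
    rintro ⟨i, hi⟩
    exact (Fin.castSucc_lt_last (π i)).ne hi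
  have hbl : (L.map fun i => b i (Fin.last (2 * k))) = List.ofFn (f ∘ π) := by
    rw [hLdef, List.map_ofFn]; rfl
  have hlen : L.length = 2 * k := by simp [hLdef]
  have hA := hw_prod_last b β hβ _ L hlast
  rw [hbl, hlen] at hA
  have hcount : (List.ofFn (f ∘ π)).countP (fun x => decide (x = 1 / 2)) =
      (Finset.univ.filter (fun i : Fin (2 * k) => f i = 1 / 2)).card := by
    rw [List.ofFn_eq_map, List.countP_map, List.countP_eq_length_filter]
    have h1 : (Finset.univ.filter (fun i : Fin (2 * k) => f i = 1 / 2)).card =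
        (Finset.univ.filter (fun i : Fin (2 * k) => f (π i) = 1 / 2)).card := by
      rw [Finset.card_filter, Finset.card_filter]
      exact (Equiv.sum_comp π (fun i => if f i = 1 / 2 then 1 else 0)).symm
    rw [h1]
    rw [← List.toFinset_card_of_nodup ((List.nodup_finRange _).filter _)]
    congr 1
    ext i
    simp
  have hc : hwAlt (List.ofFn (f ∘ π)) = 1 / 2 ∨ hwAlt (List.ofFn (f ∘ π)) = - (1 / 2) := by
    rcases hwAlt_sorted (fun x => decide (x = 1 / 2)) (by simp) (by simp) (List.ofFn (f ∘ π))
      (by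
        intro x hx
        obtain ⟨i, rfl⟩ := List.mem_ofFn.1 hx
        exact hb _ _)
      (List.pairwise_ofFn.2 fun i j hij => hmono hij.le) with ⟨h1, _⟩ | ⟨_, h2⟩
    · rw [hcount] at h1
      exact absurd h1 (Nat.not_even_iff_odd.2 hodd)
    · exact h2
  have hsq : ∀ v, ∀ j : Fin (2 * k), ((L.map β).prod ^ 2) v j.castSucc = v j.castSucc := by
    intro v j
    obtain ⟨c, hc⟩ := hw_prod_coord b β hβ j.castSucc L
    have hs : (L.map fun i => if j.castSucc = i then (1:ℝ) else -1).prod = -1 := by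
      rw [hLdef, List.map_ofFn, List.prod_ofFn]
      simp only [Function.comp, Fin.castSucc_inj]
      rw [Equiv.prod_comp π (fun i => if j = i then (1:ℝ) else -1)]
      have : ∀ i : Fin (2 * k), (if j = i then (1:ℝ) else -1) = (if j = i then -1 else 1) * (-1) := by
        intro i; split_ifs <;> norm_num
      simp only [this]
      rw [Finset.prod_mul_distrib, Finset.prod_ite_eq]
      simp
    rw [hs] at hc
    simp only [pow_two, AffineEquiv.mul_def, AffineEquiv.trans_apply, hc]
    ring
  have hsl : ∀ v, ((L.map β).prod ^ 2) v (Fin.last (2 * k)) =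
      v (Fin.last (2 * k)) + 2 * hwAlt (List.ofFn (f ∘ π)) := by
    intro v
    rw [pow_two, AffineEquiv.mul_def, AffineEquiv.trans_apply, hA, hA]
    simp only [pow_mul]
    norm_num
    ring
  refine ⟨π, ?_⟩
  rw [hP]
  rcases hc with hc | hc
  · left
    intro v
    ext j
    refine Fin.lastCases ?_ (fun j => ?_) j
    · rw [hsl, hc]; simp
    · rw [hsq]; simp [(Fin.castSucc_lt_last j).ne]
  · right
    intro v
    ext j
    refine Fin.lastCases ?_ (fun j => ?_) j
    · rw [hsl, hc]; simp [sub_eq_add_neg]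
    · rw [hsq]; simp [(Fin.castSucc_lt_last j).ne]
end

section
/- Let n = 2k + 1 with k ≥ 1. For 1 ≤ i ≤ n let B_i be the n×n diagonal real matrix whose (i,i) entry is 1 and whose other diagonal entries are −1, let b_i ∈ ℝ^n have all coordinates in {0, 1/2} with i-th coordinate of b_i equal to 1/2, and let β_i be the affine transformation v ↦ B_i v + b_i of ℝ^n. Let Γ be the subgroup of affine transformations generated by β_1, …, β_n. Assume that every pure translation belonging to Γ is translation by a vector in ℤ^n, and that the number of indices i ∈ {1, …, n−1} for which the n-th coordinate of b_i equals 1/2 is odd. Then β_n lies in the subgroup generated by β_1, …, β_{n−1}; consequently Γ is generated by β_1, …, β_{n−1}, and the homomorphism Φ : G_{n−1} → Γ with Φ(x_i) = β_i is surjective. -/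
theorem hw_mul_apply {m : ℕ} (f g : (Fin m → ℝ) ≃ᵃ[ℝ] (Fin m → ℝ)) (v : Fin m → ℝ) :
    (f * g) v = f (g v) := rfl

theorem hw_prod_form {m : ℕ} (b : Fin m → Fin m → ℝ)
    (β : Fin m → ((Fin m → ℝ) ≃ᵃ[ℝ] (Fin m → ℝ)))
    (hβ : ∀ i v j, β i v j = (if j = i then v j else -v j) + b i j) (l : List (Fin m)) :
    ∃ c : Fin m → ℝ, ∀ v j, (l.map β).prod v j =
      (l.map (fun i => if j = i then (1 : ℝ) else -1)).prod * v j + c j := by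
  induction l with
  | nil => exact ⟨0, fun v j => by simp⟩
  | cons a l ih =>
    obtain ⟨c, hc⟩ := ih
    refine ⟨fun j => (if j = a then c j else -c j) + b a j, fun v j => ?_⟩
    simp only [List.map_cons, List.prod_cons, hw_mul_apply, hβ, hc]
    split_ifs <;> ring

theorem hw_int_mem {m : ℕ} (H : Subgroup ((Fin m → ℝ) ≃ᵃ[ℝ] (Fin m → ℝ)))
    (h : ∀ i, AffineEquiv.constVAddHom ℝ (Fin m → ℝ)
      (Multiplicative.ofAdd (Pi.single i (1 : ℝ))) ∈ H)
    (t : Fin m → ℝ) (ht : ∀ j, ∃ z : ℤ, t j = z) :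
    AffineEquiv.constVAddHom ℝ (Fin m → ℝ) (Multiplicative.ofAdd t) ∈ H := by
  choose z hz using ht
  let S : AddSubgroup (Fin m → ℝ) := Subgroup.toAddSubgroup'
    (H.comap (AffineEquiv.constVAddHom ℝ (Fin m → ℝ)))
  have : t = ∑ i, z i • (Pi.single i (1 : ℝ) : Fin m → ℝ) := by
    ext j
    simp [Finset.sum_apply, Pi.single_apply, hz]
  change t ∈ S
  rw [this]
  exact S.sum_mem fun i _ => S.zsmul_mem (h i) _

/-- Let `n = 2k + 1` with `k ≥ 1`, and for `1 ≤ i ≤ n` let `β_i : v ↦ B_i v + b_i` be the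
affine transformation of `ℝ^n` where `B_i` is diagonal with `(i,i)` entry `1` and other
diagonal entries `-1`, all coordinates of `b_i` lie in `{0, 1/2}`, and the `i`-th
coordinate of `b_i` is `1/2`.  Let `Γ = ⟨β_1, …, β_n⟩`.  If every pure translation in `Γ`
is translation by an integer vector, and the number of indices `i ∈ {1, …, n-1}` with
`n`-th coordinate of `b_i` equal to `1/2` is odd, then `β_n ∈ ⟨β_1, …, β_{n-1}⟩`;
consequently `Γ = ⟨β_1, …, β_{n-1}⟩` and the homomorphism `Φ : G_{n-1} → Aff(ℝ^n)` with
`Φ(x_i) = β_i` has range `Γ`, i.e. is surjective onto `Γ`. -/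
theorem hw_group_generated_by_first (k : ℕ) (hk : 1 ≤ k)
    (b : Fin (2 * k + 1) → Fin (2 * k + 1) → ℝ)
    (hb : ∀ i j, b i j = 0 ∨ b i j = 1 / 2) (hbi : ∀ i, b i i = 1 / 2)
    (β : Fin (2 * k + 1) → ((Fin (2 * k + 1) → ℝ) ≃ᵃ[ℝ] (Fin (2 * k + 1) → ℝ)))
    (hβ : ∀ i v j, β i v j = (if j = i then v j else -v j) + b i j)
    (htrans : ∀ g ∈ Subgroup.closure (Set.range β), ∀ t : Fin (2 * k + 1) → ℝ,
      (∀ v, g v = v + t) → ∀ j, ∃ m : ℤ, t j = (m : ℝ))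
    (hodd : Odd (Finset.univ.filter
      (fun i : Fin (2 * k) => b i.castSucc (Fin.last (2 * k)) = 1 / 2)).card) :
    β (Fin.last (2 * k)) ∈
      Subgroup.closure (Set.range fun i : Fin (2 * k) => β i.castSucc) ∧
    Subgroup.closure (Set.range β) =
      Subgroup.closure (Set.range fun i : Fin (2 * k) => β i.castSucc) ∧
    ∀ Φ : GHW (2 * k) →* ((Fin (2 * k + 1) → ℝ) ≃ᵃ[ℝ] (Fin (2 * k + 1) → ℝ)),
      (∀ i : Fin (2 * k), Φ (ghw i) = β i.castSucc) →
      Φ.range = Subgroup.closure (Set.range β) := by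
  classical
  set H := Subgroup.closure (Set.range fun i : Fin (2 * k) => β i.castSucc) with hH
  have hβH : ∀ i : Fin (2 * k), β i.castSucc ∈ H := fun i =>
    Subgroup.subset_closure ⟨i, rfl⟩
  have hle : H ≤ Subgroup.closure (Set.range β) := by
    rw [hH, Subgroup.closure_le]
    rintro _ ⟨i, rfl⟩
    exact Subgroup.subset_closure ⟨_, rfl⟩
  have hsq : ∀ i : Fin (2 * k), AffineEquiv.constVAddHom ℝ (Fin (2 * k + 1) → ℝ)
      (Multiplicative.ofAdd (Pi.single i.castSucc (1 : ℝ))) ∈ H := by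
    intro i
    have : AffineEquiv.constVAddHom ℝ (Fin (2 * k + 1) → ℝ)
      (Multiplicative.ofAdd (Pi.single i.castSucc (1 : ℝ))) = β i.castSucc * β i.castSucc := by
      ext v j
      simp only [hw_mul_apply, hβ, AffineEquiv.constVAddHom_apply,
        AffineEquiv.constVAdd_apply, toAdd_ofAdd, vadd_eq_add, Pi.add_apply, Pi.single_apply]
      split_ifs with hj
      · subst hj; rw [hbi]; ring
      · ring
    rw [this]
    exact H.mul_mem (hβH i) (hβH i)
  obtain ⟨p, hp⟩ : ∃ p : Fin (2 * k), b p.castSucc (Fin.last (2 * k)) = 1 / 2 := by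
    by_contra! hc
    rw [Finset.filter_false_of_mem (fun i _ => hc i)] at hodd
    simp at hodd
  obtain ⟨q, hq⟩ : ∃ q : Fin (2 * k), b q.castSucc (Fin.last (2 * k)) = 0 := by
    by_contra! hc
    rw [Finset.filter_true_of_mem (fun i _ => (hb _ _).resolve_left (hc i))] at hodd
    simp only [Finset.card_univ, Fintype.card_fin] at hodd
    exact (Nat.not_odd_iff_even.2 (even_two_mul k)) hodd
  obtain ⟨t, htl, ht⟩ : ∃ t : Fin (2 * k + 1) → ℝ, t (Fin.last _) = 1 ∧ ∀ v,
      (β p.castSucc * β q.castSucc) v = (β q.castSucc * β p.castSucc) v + t := by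
    refine ⟨(β p.castSucc * β q.castSucc) 0 - (β q.castSucc * β p.castSucc) 0, ?_, ?_⟩
    · have h1 := (Fin.castSucc_lt_last p).ne'
      have h2 := (Fin.castSucc_lt_last q).ne'
      simp only [Pi.sub_apply, hw_mul_apply, hβ, h1, h2, if_false, hp, hq]
      norm_num
    · intro v
      ext j
      simp only [Pi.add_apply, Pi.sub_apply, hw_mul_apply, hβ, Pi.zero_apply]
      split_ifs <;> ring
  have htg : ∀ v, ((β p.castSucc * β q.castSucc) * (β q.castSucc * β p.castSucc)⁻¹) v = v + t := by
    intro v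
    rw [hw_mul_apply, ht, ← hw_mul_apply, mul_inv_cancel]
    rfl
  have hgH : (β p.castSucc * β q.castSucc) * (β q.castSucc * β p.castSucc)⁻¹ ∈ H :=
    H.mul_mem (H.mul_mem (hβH _) (hβH _)) (H.inv_mem (H.mul_mem (hβH _) (hβH _)))
  have htint := htrans _ (hle hgH) t htg
  have htH : AffineEquiv.constVAddHom ℝ (Fin (2 * k + 1) → ℝ) (Multiplicative.ofAdd t) ∈ H := by
    convert hgH using 1
    ext1 v
    rw [htg]
    exact add_comm t v
  have hlast : AffineEquiv.constVAddHom ℝ (Fin (2 * k + 1) → ℝ)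
      (Multiplicative.ofAdd (Pi.single (Fin.last (2 * k)) (1 : ℝ))) ∈ H := by
    choose z hz using htint
    let S : AddSubgroup (Fin (2 * k + 1) → ℝ) := Subgroup.toAddSubgroup'
      (H.comap (AffineEquiv.constVAddHom ℝ (Fin (2 * k + 1) → ℝ)))
    have : (Pi.single (Fin.last (2 * k)) (1 : ℝ) : Fin (2 * k + 1) → ℝ) =
        t - ∑ i : Fin (2 * k), z i.castSucc • (Pi.single i.castSucc (1 : ℝ)) := by
      have h0 : t = ∑ i, z i • (Pi.single i (1 : ℝ) : Fin (2 * k + 1) → ℝ) := by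
        ext j
        simp [Finset.sum_apply, Pi.single_apply, hz]
      have h1 : z (Fin.last (2 * k)) = 1 := by
        have := hz (Fin.last (2 * k))
        rw [htl] at this
        exact_mod_cast this.symm
      rw [Fin.sum_univ_castSucc, h1, one_smul] at h0
      rw [eq_sub_iff_add_eq]
      exact (add_comm _ _).trans h0.symm
    change _ ∈ S
    rw [this]
    exact S.sub_mem htH (S.sum_mem fun i _ => S.zsmul_mem (hsq i) _)
  have hall := hw_int_mem H (fun i => Fin.lastCases hlast hsq i)
  have hmem : β (Fin.last (2 * k)) ∈ H := by
    obtain ⟨c, hc⟩ := hw_prod_form b β hβ (List.ofFn fun i => i)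
    have hsign : ∀ j : Fin (2 * k + 1), ((List.ofFn fun i : Fin (2 * k + 1) => i).map
        (fun i => if j = i then (1 : ℝ) else -1)).prod = 1 := by
      intro j
      rw [List.map_ofFn, List.prod_ofFn, ← Finset.mul_prod_erase _ _ (Finset.mem_univ j),
        Finset.prod_congr rfl (g := fun _ => (-1 : ℝ))]
      · simp
      · intro x hx
        simp [(Finset.ne_of_mem_erase hx).symm]
    have hc' : ∀ v, ((List.ofFn fun i : Fin (2 * k + 1) => i).map β).prod v = v + c := by
      intro v
      ext j
      rw [hc, hsign, one_mul, Pi.add_apply]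
    have hcint := htrans _ (Subgroup.list_prod_mem _ (by
      intro x hx
      obtain ⟨i, _, rfl⟩ := List.mem_map.1 hx
      exact Subgroup.subset_closure ⟨i, rfl⟩)) c hc'
    have hcH := hall c hcint
    have heq : AffineEquiv.constVAddHom ℝ (Fin (2 * k + 1) → ℝ) (Multiplicative.ofAdd c) =
        (List.ofFn fun i : Fin (2 * k) => β i.castSucc).prod * β (Fin.last (2 * k)) := by
      have : ((List.ofFn fun i : Fin (2 * k + 1) => i).map β).prod =
          (List.ofFn fun i : Fin (2 * k) => β i.castSucc).prod * β (Fin.last (2 * k)) := by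
        rw [List.map_ofFn, List.ofFn_succ', List.concat_eq_append, List.prod_append,
          List.prod_singleton]
        rfl
      rw [← this]
      ext1 v
      rw [hc']
      exact add_comm c v
    rw [heq] at hcH
    refine (H.mul_mem_cancel_left (H.list_prod_mem ?_)).1 hcH
    intro x hx
    obtain ⟨i, rfl⟩ := (List.mem_ofFn' _ _).1 hx
    exact hβH i
  have hEq : Subgroup.closure (Set.range β) = H := by
    refine le_antisymm ?_ hle
    rw [Subgroup.closure_le]
    rintro _ ⟨i, rfl⟩
    exact Fin.lastCases (motive := fun i => β i ∈ H) hmem hβH i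
  refine ⟨hmem, hEq, fun Φ hΦ => ?_⟩
  rw [hEq, hH, MonoidHom.range_eq_map, ← PresentedGroup.closure_range_of, MonoidHom.map_closure,
    ← Set.range_comp]
  congr 2
  ext1 i
  exact hΦ i
end

section
/- Let n ≥ 2. For 1 ≤ i ≤ n−1 let B_i be the n×n diagonal real matrix whose (i,i) entry is 1 and whose other diagonal entries are −1, let b_i ∈ ℝ^n have i-th coordinate equal to 1/2, and let β_i be the affine transformation v ↦ B_i v + b_i of ℝ^n. Let Φ : G_{n−1} → (affine transformations of ℝ^n) be the homomorphism with Φ(x_i) = β_i, and let A_{n−1} be the subgroup of G_{n−1} generated by x_1^2, …, x_{n−1}^2. Then ker Φ ∩ A_{n−1} = 1. -/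
/-- Let `n = m + 1 ≥ 2`.  For `1 ≤ i ≤ n - 1 = m`, let `β_i : v ↦ B_i v + b_i` be the
affine transformation of `ℝ^n`, where `B_i` is diagonal with `(i,i)` entry `1` and other
diagonal entries `-1`, and the `i`-th coordinate of `b_i` is `1/2`.  If
`Φ : G_{n-1} → Aff(ℝ^n)` is the homomorphism with `Φ(x_i) = β_i`, then
`ker Φ ∩ A_{n-1} = 1`. -/
theorem hw_affine_ker_inter_squares_trivial (m : ℕ) (hm : 1 ≤ m)
    (b : Fin m → Fin (m + 1) → ℝ) (hb : ∀ i : Fin m, b i i.castSucc = 1 / 2)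
    (β : Fin m → ((Fin (m + 1) → ℝ) ≃ᵃ[ℝ] (Fin (m + 1) → ℝ)))
    (hβ : ∀ (i : Fin m) v (j : Fin (m + 1)),
      β i v j = (if j = i.castSucc then v j else -v j) + b i j)
    (Φ : GHW m →* ((Fin (m + 1) → ℝ) ≃ᵃ[ℝ] (Fin (m + 1) → ℝ)))
    (hΦ : ∀ i : Fin m, Φ (ghw i) = β i) :
    Φ.ker ⊓ Subgroup.closure (Set.range fun i : Fin m => (ghw i : GHW m) ^ 2) = ⊥ := by
  classical
  have hrel : ∀ i j : Fin m, i ≠ j →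
      (ghw i : GHW m)⁻¹ * ghw j ^ 2 * ghw i * ghw j ^ 2 = 1 := by
    intro i j hij
    have h := PresentedGroup.one_of_mem (rels := HWrels m) (x := (FreeGroup.of i)⁻¹ *
      (FreeGroup.of j) ^ 2 * FreeGroup.of i * (FreeGroup.of j) ^ 2) ⟨i, j, hij, rfl⟩
    simp only [map_mul, map_inv, map_pow] at h
    exact h
  have hcomm : ∀ i j : Fin m, i ≠ j → Commute ((ghw i : GHW m) ^ 2) (ghw j ^ 2) := by
    intro i j hij
    have h := hrel i j hij
    generalize (ghw i : GHW m) = x at *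
    generalize (ghw j : GHW m) ^ 2 = y at *
    have h1 : x⁻¹ * y * x = y⁻¹ := eq_inv_of_mul_eq_one_left h
    have h3 : y * x = x * y⁻¹ := by rw [← h1]; group
    have h2 : y⁻¹ * x = x * y := by
      calc y⁻¹ * x = y⁻¹ * (x * y⁻¹) * y := by group
        _ = x * y := by rw [← h3]; group
    have : y * x ^ 2 = x ^ 2 * y := by
      rw [pow_two, ← mul_assoc, h3, mul_assoc, h2, mul_assoc]
    exact this.symm
  have hF : Pairwise fun i j : Fin m => ∀ x y : Multiplicative ℤ,
      Commute (zpowersHom (GHW m) (ghw i ^ 2) x) (zpowersHom (GHW m) (ghw j ^ 2) y) := by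
    intro i j hij x y
    rw [zpowersHom_apply, zpowersHom_apply]
    exact ((hcomm i j hij).zpow_zpow _ _)
  have hmul : ∀ (f g : (Fin (m + 1) → ℝ) ≃ᵃ[ℝ] (Fin (m + 1) → ℝ)) v, (f * g) v = f (g v) :=
    fun _ _ _ => rfl
  let F : (Fin m → Multiplicative ℤ) →* GHW m :=
    MonoidHom.noncommPiCoprod (fun i => zpowersHom (GHW m) (ghw i ^ 2)) hF
  have key : ∀ a ∈ Subgroup.closure (Set.range fun i : Fin m => (ghw i : GHW m) ^ 2),
      ∃ k : Fin m → Multiplicative ℤ, a = F k ∧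
        ∀ v j, Φ a v (Fin.castSucc j) = v (Fin.castSucc j) + ((k j).toAdd : ℝ) := by
    intro a ha
    induction ha using Subgroup.closure_induction with
    | mem x hx =>
      obtain ⟨i, rfl⟩ := hx
      refine ⟨Pi.mulSingle i (Multiplicative.ofAdd 1), ?_, ?_⟩
      · have h := MonoidHom.noncommPiCoprod_mulSingle
          (ϕ := fun i => zpowersHom (GHW m) (ghw i ^ 2)) (hcomm := hF) i (Multiplicative.ofAdd 1)
        refine Eq.trans ?_ h.symm
        simp [zpowersHom_apply]
      · intro v j
        have h0 : Φ ((ghw i : GHW m) ^ 2) v = β i (β i v) := by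
          rw [pow_two, map_mul, hΦ, hmul]
        refine (congrFun h0 j.castSucc).trans ?_
        rw [hβ, hβ]
        by_cases h : j = i
        · subst h
          simp [hb]; ring
        · simp [h]
    | one => exact ⟨1, by simp, by simp⟩
    | mul x y _ _ hx hy =>
      obtain ⟨k, rfl, hk⟩ := hx
      obtain ⟨l, rfl, hl⟩ := hy
      refine ⟨k * l, by simp, ?_⟩
      intro v j
      rw [map_mul, hmul, hk, hl]
      simp; ring
    | inv x _ hx =>
      obtain ⟨k, rfl, hk⟩ := hx
      refine ⟨k⁻¹, by simp, ?_⟩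
      intro v j
      have h := hk (Φ (F k)⁻¹ v) j
      rw [← hmul, ← map_mul, mul_inv_cancel, map_one] at h
      simp only [AffineEquiv.coe_one, id] at h
      rw [h]; simp
  rw [eq_bot_iff]
  rintro a ⟨h1, h2⟩
  obtain ⟨k, rfl, hk⟩ := key a h2
  have h1' : Φ (F k) = 1 := h1
  have : k = 1 := by
    funext j
    have h := hk 0 j
    rw [h1'] at h
    simp at h
    have h' : (k j).toAdd = 0 := by exact_mod_cast h.symm
    exact h'
  rw [this]; simp
end
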